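/- arXiv:1911.07218 — 10 statements merged into one kernel-verified Lean document; each statement's English description precedes it below -/
import Mathlib

section
/- Let L be a real symmetric m×m matrix, M a real skew-symmetric m×m matrix, and ζ₁, ζ₂ ∈ ℝᵐ vectors with L·ζ₁ = 0, L·ζ₂ = M·ζ₁ and ⟨M·ζ₁, ζ₂⟩ ≠ 0. Then there is no vector ζ₃ ∈ ℝᵐ with L·ζ₃ = M·ζ₂; that is, M·ζ₂ does not lie in the range of L, so the Jordan chain ζ₁, ζ₂ has length exactly two. -/
open Matrix

/-- **Jordan chains have length exactly two.** If `L` is symmetric, `M` is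
skew-symmetric, `L ζ₁ = 0`, `L ζ₂ = M ζ₁`, and `⟨M ζ₁, ζ₂⟩ ≠ 0`, then there is
no `ζ₃` with `L ζ₃ = M ζ₂`. -/
theorem jordan_chain_length_two {m : ℕ} (L M : Matrix (Fin m) (Fin m) ℝ)
    (hL : Lᵀ = L) (hM : Mᵀ = -M) (ζ₁ ζ₂ : Fin m → ℝ)
    (h1 : L.mulVec ζ₁ = 0) (h2 : L.mulVec ζ₂ = M.mulVec ζ₁)
    (hne : M.mulVec ζ₁ ⬝ᵥ ζ₂ ≠ 0) :
    ¬ ∃ ζ₃ : Fin m → ℝ, L.mulVec ζ₃ = M.mulVec ζ₂ := by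
  rintro ⟨ζ₃, h3⟩
  apply hne
  calc M *ᵥ ζ₁ ⬝ᵥ ζ₂ = ζ₁ ⬝ᵥ Mᵀ *ᵥ ζ₂ := by rw [dotProduct_mulVec, vecMul_transpose]
    _ = -(ζ₁ ⬝ᵥ L *ᵥ ζ₃) := by rw [hM, neg_mulVec, dotProduct_neg, h3]
    _ = -(ζ₁ ⬝ᵥ Lᵀ *ᵥ ζ₃) := by rw [hL]
    _ = 0 := by rw [dotProduct_mulVec, vecMul_transpose, h1, zero_dotProduct, neg_zero]
end

section
/- Let L be a real symmetric (2n)×(2n) matrix whose kernel is one-dimensional and spanned by a unit vector ζ₁, let M be a real skew-symmetric (2n)×(2n) matrix, and let ζ₂ ∈ ℝ^{2n} satisfy L·ζ₂ = M·ζ₁. Let μ(L) denote the product of the nonzero eigenvalues of L, equivalently μ(L) = −c₁ where c₁ is the coefficient of X in the characteristic polynomial det(X·I − L). Then the entrywise derivative at λ = 0 of the matrix-valued polynomial map λ ↦ adjugate(L − λM) equals μ(L)·(ζ₂ζ₁ᵀ − ζ₁ζ₂ᵀ). -/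
open Matrix

open Polynomial in
/-- The linear matrix pencil `P + X Q`. -/
noncomputable def pencil {m R : Type*} [CommRing R] (P Q : Matrix m m R) : Matrix m m R[X] :=
  P.map C + (X : R[X]) • Q.map C

section Pencil

open Polynomial

variable {m R : Type*} [CommRing R] (P Q : Matrix m m R)

theorem pencil_map_coeff_zero : (pencil P Q).map (coeff · 0) = P := by
  ext i j
  simp [pencil]

theorem pencil_map_coeff_one : (pencil P Q).map (coeff · 1) = Q := by
  ext i j
  simp [pencil, coeff_C]

variable [Fintype m]

theorem map_coeff_one_mul (A B : Matrix m m R[X]) :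
    (A * B).map (coeff · 1) =
      A.map (coeff · 0) * B.map (coeff · 1) + A.map (coeff · 1) * B.map (coeff · 0) := by
  ext i j
  simp [mul_apply, mul_coeff_one, Finset.sum_add_distrib]

variable [DecidableEq m]

/-- The first-order coefficient of `adjugate (P + X Q)`. -/
noncomputable def adjugateDeriv : Matrix m m R :=
  (pencil P Q).adjugate.map (coeff · 1)

theorem pencil_adjugate_map_coeff_zero :
    (pencil P Q).adjugate.map (coeff · 0) = P.adjugate := by
  have h := (constantCoeff (R := R)).map_adjugate (pencil P Q)
  have h0 : constantCoeff.mapMatrix (pencil P Q) = P := pencil_map_coeff_zero P Q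
  rwa [h0] at h

theorem adjugateDeriv_mul_add :
    adjugateDeriv P Q * P + P.adjugate * Q = (pencil P Q).det.coeff 1 • (1 : Matrix m m R) := by
  have h := congrArg (fun A => A.map (coeff · 1)) (adjugate_mul (pencil P Q))
  simp only [map_coeff_one_mul, pencil_adjugate_map_coeff_zero, pencil_map_coeff_zero,
    pencil_map_coeff_one] at h
  rw [adjugateDeriv, add_comm, h]
  ext i j
  by_cases hij : i = j <;> simp [one_apply, hij]

theorem mul_adjugateDeriv_add :
    P * adjugateDeriv P Q + Q * P.adjugate = (pencil P Q).det.coeff 1 • (1 : Matrix m m R) := by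
  have h := congrArg (fun A => A.map (coeff · 1)) (mul_adjugate (pencil P Q))
  simp only [map_coeff_one_mul, pencil_adjugate_map_coeff_zero, pencil_map_coeff_zero,
    pencil_map_coeff_one] at h
  rw [adjugateDeriv, h]
  ext i j
  by_cases hij : i = j <;> simp [one_apply, hij]

theorem adjugateDeriv_transpose : (adjugateDeriv P Q)ᵀ = adjugateDeriv Pᵀ Qᵀ := by
  have h : (pencil P Q)ᵀ = pencil Pᵀ Qᵀ := rfl
  rw [adjugateDeriv, adjugateDeriv, ← h, ← adjugate_transpose]
  rfl

theorem adjugateDeriv_neg : adjugateDeriv P (-Q) = -adjugateDeriv P Q := by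
  have h : (compRingHom (C (-1) * X : R[X])).mapMatrix (pencil P Q) = pencil P (-Q) := by
    ext1 i j
    simp [pencil]
  ext i j
  rw [adjugateDeriv, ← h, ← RingHom.map_adjugate]
  change (((pencil P Q).adjugate i j).comp (C (-1) * X)).coeff 1 =
    -((pencil P Q).adjugate i j).coeff 1
  rw [comp_C_mul_X_coeff, pow_one, mul_neg_one]

theorem charmatrix_eq_pencil : charmatrix P = pencil (-P) 1 := by
  ext1 i j
  by_cases hij : i = j <;> simp [pencil, one_apply, hij, sub_eq_neg_add]

theorem charpoly_eq_det_pencil : P.charpoly = (pencil (-P) 1).det := by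
  rw [charpoly, charmatrix_eq_pencil]

theorem adjugate_neg_mulVec_of_mulVec_eq_zero {v : m → R} (hv : P *ᵥ v = 0) :
    (-P).adjugate *ᵥ v = P.charpoly.coeff 1 • v := by
  have h := congrArg (· *ᵥ v) (adjugateDeriv_mul_add (-P) 1)
  simpa [add_mulVec, ← mulVec_mulVec, neg_mulVec, hv, smul_mulVec,
    ← charpoly_eq_det_pencil] using h

end Pencil

open Polynomial in
theorem hasDerivAt_adjugate_add_smul {m : Type*} [Fintype m] [DecidableEq m]
    (P Q : Matrix m m ℝ) (i j : m) :
    HasDerivAt (fun t : ℝ => (P + t • Q).adjugate i j) (adjugateDeriv P Q i j) 0 := by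
  have h : ∀ t : ℝ, (P + t • Q).adjugate i j = ((pencil P Q).adjugate i j).eval t := by
    intro t
    have ht : (evalRingHom t).mapMatrix (pencil P Q) = P + t • Q := by
      ext i j
      simp [pencil]
      ring
    rw [← ht, ← RingHom.map_adjugate]
    rfl
  rw [funext h]
  have hd : adjugateDeriv P Q i j = (derivative ((pencil P Q).adjugate i j)).eval 0 := by
    rw [← coeff_zero_eq_eval_zero, coeff_derivative]
    simp [adjugateDeriv]
  rw [hd]
  exact ((pencil P Q).adjugate i j).hasDerivAt 0

theorem exists_eq_vecMulVec_of_mul_eq_zero {m K : Type*} [Fintype m] [DecidableEq m] [Field K]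
    {L D : Matrix m m K} {v : m → K}
    (hker : LinearMap.ker L.mulVecLin = Submodule.span K {v}) (h : L * D = 0) :
    ∃ w, D = vecMulVec v w := by
  have hcol : ∀ j, ∃ c : K, c • v = D.col j := by
    intro j
    rw [← Submodule.mem_span_singleton, ← hker, LinearMap.mem_ker, mulVecLin_apply]
    ext i
    simpa [mul_apply, mulVec, dotProduct] using congrFun (congrFun h i) j
  choose w hw using hcol
  refine ⟨w, ?_⟩
  ext i j
  simpa [vecMulVec_apply, mul_comm] using (congrFun (hw j) i).symm

theorem eq_smul_vecMulVec_of_mul_eq_zero {m K : Type*} [Fintype m] [DecidableEq m] [Field K]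
    {L D : Matrix m m K} {v : m → K} (hL : Lᵀ = L)
    (hker : LinearMap.ker L.mulVecLin = Submodule.span K {v}) (hv : v ⬝ᵥ v = 1)
    (h : L * D = 0) (h' : D * L = 0) :
    D = (v ⬝ᵥ D *ᵥ v) • vecMulVec v v := by
  obtain ⟨w, hw⟩ := exists_eq_vecMulVec_of_mul_eq_zero hker h
  obtain ⟨u, hu⟩ := exists_eq_vecMulVec_of_mul_eq_zero (D := Dᵀ) hker
    (by rw [← hL, ← transpose_mul, h', transpose_zero])
  have hvw : v ᵥ* D = w := by rw [hw, vecMul_vecMulVec, hv, one_smul]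
  have hwv : w = (u ⬝ᵥ v) • v := by
    rw [← hvw, ← mulVec_transpose, hu, vecMulVec_mulVec]
    simp
  have hc : v ⬝ᵥ D *ᵥ v = u ⬝ᵥ v := by
    rw [dotProduct_mulVec, hvw, hwv, smul_dotProduct, hv, smul_eq_mul, mul_one]
  rw [hc, ← vecMulVec_smul, ← hwv, hw]

theorem dotProduct_mulVec_self_of_transpose_eq_neg {m : Type*} [Fintype m] {M : Matrix m m ℝ}
    (hM : Mᵀ = -M) (v : m → ℝ) : v ⬝ᵥ M *ᵥ v = 0 := by
  have h : v ⬝ᵥ M *ᵥ v = -(v ⬝ᵥ M *ᵥ v) := by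
    conv_lhs => rw [dotProduct_mulVec, ← mulVec_transpose, hM, neg_mulVec, neg_dotProduct,
      dotProduct_comm]
  linarith

theorem adjugate_eq_smul_vecMulVec {n : ℕ} {L : Matrix (Fin (2 * n)) (Fin (2 * n)) ℝ}
    {v : Fin (2 * n) → ℝ} (hL : Lᵀ = L)
    (hker : LinearMap.ker L.mulVecLin = Submodule.span ℝ {v}) (hv : v ⬝ᵥ v = 1) :
    L.adjugate = (-(L.charpoly.coeff 1)) • vecMulVec v v := by
  have hLv : L *ᵥ v = 0 := by
    have : v ∈ LinearMap.ker L.mulVecLin := hker ▸ Submodule.mem_span_singleton_self v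
    simpa using this
  have hv0 : v ≠ 0 := by
    rintro rfl
    simp at hv
  have hdet : L.det = 0 := exists_mulVec_eq_zero_iff.mp ⟨v, hv0, hLv⟩
  have hn : n ≠ 0 := by
    rintro rfl
    exact hv0 (funext fun i => Fin.elim0 i)
  have hodd : Odd (2 * n - 1) := ⟨n - 1, by omega⟩
  have hneg : (-L).adjugate = -L.adjugate := by
    rw [← neg_one_smul ℝ L, adjugate_smul, Fintype.card_fin, hodd.neg_one_pow, neg_one_smul]
  have hAv : L.adjugate *ᵥ v = (-(L.charpoly.coeff 1)) • v := by
    have h := adjugate_neg_mulVec_of_mulVec_eq_zero L hLv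
    rw [hneg, neg_mulVec] at h
    rw [neg_smul, ← h, neg_neg]
  have h := eq_smul_vecMulVec_of_mul_eq_zero (D := L.adjugate) hL hker hv
    (by rw [mul_adjugate, hdet, zero_smul]) (by rw [adjugate_mul, hdet, zero_smul])
  rwa [hAv, dotProduct_smul, hv, smul_eq_mul, mul_one] at h

/-- **Derivative of the adjugate at `λ = 0`.** Let `L` be a real symmetric
`2n × 2n` matrix with one-dimensional kernel spanned by a unit vector `ζ₁`,
let `M` be skew-symmetric, and let `ζ₂` satisfy `L ζ₂ = M ζ₁`. With
`μ(L) = -(coeff of X in charpoly L)` (the product of the nonzero eigenvalues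
of `L`), the entrywise derivative at `λ = 0` of `λ ↦ adjugate (L - λ M)` is
`μ(L) • (ζ₂ ζ₁ᵀ - ζ₁ ζ₂ᵀ)`. -/
theorem adjugate_deriv_at_zero {n : ℕ}
    (L M : Matrix (Fin (2 * n)) (Fin (2 * n)) ℝ)
    (hL : Lᵀ = L) (hM : Mᵀ = -M)
    (ζ₁ ζ₂ : Fin (2 * n) → ℝ)
    (hker : LinearMap.ker L.mulVecLin = Submodule.span ℝ {ζ₁})
    (hunit : ζ₁ ⬝ᵥ ζ₁ = 1)
    (h2 : L.mulVec ζ₂ = M.mulVec ζ₁) :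
    ∀ i j, HasDerivAt (fun lam : ℝ => (L - lam • M).adjugate i j)
      (((-(L.charpoly.coeff 1)) • (vecMulVec ζ₂ ζ₁ - vecMulVec ζ₁ ζ₂)) i j) 0 := by
  set μ := -(L.charpoly.coeff 1)
  set B := adjugateDeriv L (-M)
  have hA : L.adjugate = μ • vecMulVec ζ₁ ζ₁ := adjugate_eq_smul_vecMulVec hL hker hunit
  have hLζ : L *ᵥ ζ₁ = 0 := by
    have : ζ₁ ∈ LinearMap.ker L.mulVecLin := hker ▸ Submodule.mem_span_singleton_self ζ₁
    simpa using this
  have hζL : ζ₁ ᵥ* L = 0 := by rw [← mulVec_transpose, hL, hLζ]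
  have hζ₂L : ζ₂ ᵥ* L = M *ᵥ ζ₁ := by rw [← mulVec_transpose, hL, h2]
  have hζM : ζ₁ ᵥ* M = -(M *ᵥ ζ₁) := by rw [← mulVec_transpose, hM, neg_mulVec]
  have hl := mul_adjugateDeriv_add L (-M)
  have hr := adjugateDeriv_mul_add L (-M)
  have hd : (pencil L (-M)).det.coeff 1 = 0 := by
    have h := congrArg (fun A => ζ₁ ⬝ᵥ A *ᵥ ζ₁) hr
    simpa [hA, add_mulVec, ← mulVec_mulVec, hLζ, neg_mulVec, mulVec_neg, smul_mulVec,
      vecMulVec_mulVec, hunit, dotProduct_mulVec_self_of_transpose_eq_neg hM] using h.symm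
  rw [hd, zero_smul, hA] at hl hr
  have hBt : Bᵀ = -B := by
    rw [adjugateDeriv_transpose, hL, transpose_neg, hM, adjugateDeriv_neg]
  set S := vecMulVec ζ₂ ζ₁ - vecMulVec ζ₁ ζ₂
  have hSt : Sᵀ = -S := by simp [S, transpose_sub, transpose_vecMulVec]
  have hDt : (B - μ • S)ᵀ = -(B - μ • S) := by
    rw [transpose_sub, transpose_smul, hBt, hSt, smul_neg]
    abel
  have hLD : L * (B - μ • S) = 0 := by
    rw [mul_sub, ← hl]
    simp [B, S, sub_eq_add_neg, mul_add, mul_vecMulVec, hLζ, h2]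
  have hDL : (B - μ • S) * L = 0 := by
    rw [sub_mul, ← hr]
    simp [B, S, sub_mul, vecMulVec_mul, hζL, hζ₂L, hζM]
  have hD := eq_smul_vecMulVec_of_mul_eq_zero hL hker hunit hLD hDL
  rw [dotProduct_mulVec_self_of_transpose_eq_neg hDt, zero_smul, sub_eq_zero] at hD
  intro i j
  rw [← hD]
  simpa only [smul_neg, ← sub_eq_add_neg] using hasDerivAt_adjugate_add_smul L (-M) i j
end

section
/- Let L be a real symmetric m×m matrix whose kernel is one-dimensional, and let M be a real skew-symmetric m×m matrix. Then the derivative at λ = 0 of the polynomial function D(λ) = det(L − λM) vanishes: D(0) = 0 and D′(0) = 0. -/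
open Matrix

/-- The derivative of an even real function vanishes at the origin. -/
theorem deriv_zero_of_even {f : ℝ → ℝ} (hf : ∀ x, f (-x) = f x) : deriv f 0 = 0 := by
  have h := deriv_comp_neg f 0
  simp only [hf, neg_zero] at h
  linarith

/-- For `L` symmetric and `M` skew-symmetric, `det (L - x M)` is even in `x`. -/
theorem det_sub_neg_smul_of_symm_of_skew {n R : Type*} [Fintype n] [DecidableEq n] [CommRing R]
    {L M : Matrix n n R} (hL : Lᵀ = L) (hM : Mᵀ = -M) (x : R) :
    (L - (-x) • M).det = (L - x • M).det := by
  rw [← det_transpose (L - x • M), transpose_sub, transpose_smul, hL, hM, smul_neg, neg_smul]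

/-- If `L` is a real symmetric `m × m` matrix with one-dimensional kernel and
`M` is skew-symmetric, then `D(λ) = det (L - λ M)` satisfies `D(0) = 0` and
`D′(0) = 0`. -/
theorem evans_first_derivative_vanishes {m : ℕ}
    (L M : Matrix (Fin m) (Fin m) ℝ)
    (hL : Lᵀ = L) (hM : Mᵀ = -M)
    (hker : Module.finrank ℝ (LinearMap.ker L.mulVecLin) = 1) :
    (L - (0 : ℝ) • M).det = 0 ∧
      deriv (fun lam : ℝ => (L - lam • M).det) 0 = 0 := by
  refine ⟨?_, deriv_zero_of_even (det_sub_neg_smul_of_symm_of_skew hL hM)⟩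
  rw [zero_smul, sub_zero, ← exists_mulVec_eq_zero_iff]
  have hne : LinearMap.ker L.mulVecLin ≠ ⊥ := by
    intro h
    rw [h, finrank_bot] at hker
    exact zero_ne_one hker
  obtain ⟨v, hv, hv0⟩ := Submodule.exists_mem_ne_zero_of_ne_bot hne
  exact ⟨v, hv0, by simpa using hv⟩
end

section
/- Let L be a real symmetric (2n)×(2n) matrix whose kernel is one-dimensional and spanned by a unit vector ζ₁, let M be a real skew-symmetric (2n)×(2n) matrix, and let ζ₂ ∈ ℝ^{2n} satisfy L·ζ₂ = M·ζ₁. Define D(λ) = det(L − λM) and let μ(L) denote the product of the nonzero eigenvalues of L, equivalently μ(L) = −c₁ where c₁ is the coefficient of X in the characteristic polynomial det(X·I − L). Then D(0) = 0, D′(0) = 0, and D″(0) = 2·μ(L)·⟨M·ζ₁, ζ₂⟩. -/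
open Matrix

theorem det_smul_eq_smul_adjugate_mulVec {m R : Type*} [Fintype m] [DecidableEq m] [CommRing R]
    {A : Matrix m m R} {v w : m → R} {r : R} (h : A *ᵥ v = r • w) :
    A.det • v = r • (A.adjugate *ᵥ w) := by
  rw [← mulVec_smul, ← h, mulVec_mulVec, adjugate_mul, smul_mulVec, one_mulVec]

open Polynomial in
/-- If `v` is a null vector of `A`, then the linear coefficient of the characteristic polynomial
is determined by the adjugate. -/
theorem charpoly_coeff_one_mul_dotProduct {m R : Type*} [Fintype m] [DecidableEq m] [CommRing R]
    {A : Matrix m m R} {v : m → R} (h : A *ᵥ v = 0) (hv : v ⬝ᵥ v = 1) :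
    A.charpoly.coeff 1 = v ⬝ᵥ ((-A).adjugate *ᵥ v) := by
  have h1 : A.charmatrix *ᵥ (C ∘ v) = (X : R[X]) • (C ∘ v) := by
    have h0 : A.map C *ᵥ (C ∘ v) = 0 := by
      ext1 i
      rw [← RingHom.map_mulVec, h]
      simp
    rw [charmatrix, sub_mulVec]
    simp [h0]
  have h2 := congrArg (fun u => (C ∘ v) ⬝ᵥ u) (det_smul_eq_smul_adjugate_mulVec h1)
  have h3 : (C ∘ v) ⬝ᵥ (C ∘ v) = (1 : R[X]) := by
    rw [← RingHom.map_dotProduct, hv, map_one]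
  simp only [dotProduct_smul, h3, smul_eq_mul, mul_one] at h2
  rw [charpoly, h2, coeff_X_mul, coeff_zero_eq_eval_zero, ← coe_evalRingHom,
    RingHom.map_dotProduct]
  congr 1
  · ext i; simp
  · ext i
    rw [Function.comp_apply, RingHom.map_mulVec, ← RingHom.mapMatrix_apply, RingHom.map_adjugate]
    congr 2
    · ext i j
      by_cases hij : i = j <;> simp [hij]
    · ext i; simp

open Polynomial in
/-- A second order approximate null vector of the pencil `L - X M` shows that its determinant
is divisible by `X ^ 2` up to a unit, with quotient given by the adjugate. -/
theorem det_pencil_mul_eq {m R : Type*} [Fintype m] [DecidableEq m] [CommRing R]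
    {L M : Matrix m m R} {v w : m → R} (hv : L *ᵥ v = 0) (hvv : v ⬝ᵥ v = 1)
    (hw : L *ᵥ w = M *ᵥ v) :
    (L.map C - (X : R[X]) • M.map C).det * (1 + X * C (v ⬝ᵥ w)) =
      -(X ^ 2 * ((C ∘ v) ⬝ᵥ ((L.map C - (X : R[X]) • M.map C).adjugate *ᵥ (C ∘ (M *ᵥ w))))) := by
  have hmap (A : Matrix m m R) (u : m → R) : A.map C *ᵥ (C ∘ u) = (C ∘ (A *ᵥ u) : m → R[X]) := by
    ext1 i
    exact (RingHom.map_mulVec C A u i).symm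
  have h1 : (L.map C - (X : R[X]) • M.map C) *ᵥ (C ∘ v + (X : R[X]) • (C ∘ w)) =
      (-X ^ 2 : R[X]) • (C ∘ (M *ᵥ w)) := by
    simp only [sub_mulVec, mulVec_add, smul_mulVec, mulVec_smul, hmap, hv, hw]
    ext1 i
    simp
    ring
  have h2 := congrArg (fun u => (C ∘ v) ⬝ᵥ u) (det_smul_eq_smul_adjugate_mulVec h1)
  simpa [dotProduct_smul, dotProduct_add, ← RingHom.map_dotProduct, hvv, mul_add] using h2

open Polynomial in
/-- **Theorem 2.2 (derivatives of the characteristic function).** Let `L` be a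
real symmetric `2n × 2n` matrix with one-dimensional kernel spanned by a unit
vector `ζ₁`, let `M` be skew-symmetric, and let `ζ₂` satisfy `L ζ₂ = M ζ₁`.
With `D(λ) = det (L - λ M)` and `μ(L) = -(coeff of X in charpoly L)` (the
product of the nonzero eigenvalues of `L`), one has `D(0) = 0`, `D′(0) = 0`,
and `D″(0) = 2 μ(L) ⟨M ζ₁, ζ₂⟩`. -/
theorem characteristic_function_derivatives {n : ℕ}
    (L M : Matrix (Fin (2 * n)) (Fin (2 * n)) ℝ)
    (hL : Lᵀ = L) (hM : Mᵀ = -M)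
    (ζ₁ ζ₂ : Fin (2 * n) → ℝ)
    (hker : LinearMap.ker L.mulVecLin = Submodule.span ℝ {ζ₁})
    (hunit : ζ₁ ⬝ᵥ ζ₁ = 1)
    (h2 : L.mulVec ζ₂ = M.mulVec ζ₁) :
    (L - (0 : ℝ) • M).det = 0 ∧
      deriv (fun lam : ℝ => (L - lam • M).det) 0 = 0 ∧
      deriv (deriv (fun lam : ℝ => (L - lam • M).det)) 0 =
        2 * (-(L.charpoly.coeff 1)) * (M.mulVec ζ₁ ⬝ᵥ ζ₂) := by
  have hn : n ≠ 0 := by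
    rintro rfl
    simp [dotProduct] at hunit
  have hL1 : L *ᵥ ζ₁ = 0 := by
    have : ζ₁ ∈ LinearMap.ker L.mulVecLin := hker ▸ Submodule.mem_span_singleton_self ζ₁
    simpa using this
  have hdet : L.det = 0 :=
    exists_mulVec_eq_zero_iff.mp ⟨ζ₁, by rintro rfl; simp at hunit, hL1⟩
  obtain ⟨c, hc⟩ : ∃ c : ℝ, c • ζ₁ = L.adjugate *ᵥ ζ₁ := by
    rw [← Submodule.mem_span_singleton, ← hker, LinearMap.mem_ker, mulVecLin_apply,
      mulVec_mulVec, mul_adjugate, hdet, zero_smul, zero_mulVec]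
  have hcoeff : L.charpoly.coeff 1 = -c := by
    rw [charpoly_coeff_one_mul_dotProduct hL1 hunit, ← neg_one_smul ℝ L, adjugate_smul,
      smul_mulVec, ← hc, Fintype.card_fin, Odd.neg_one_pow ⟨n - 1, by omega⟩]
    simp [hunit]
  have hpoly := det_pencil_mul_eq hL1 hunit h2
  set A : Matrix (Fin (2 * n)) (Fin (2 * n)) ℝ[X] := L.map C - (X : ℝ[X]) • M.map C with hA
  have hmap (t : ℝ) : (evalRingHom t).mapMatrix A = L - t • M := by
    ext i j
    simp [hA]
    ring
  have hD : (fun t : ℝ => (L - t • M).det) = fun t => A.det.eval t := by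
    ext t
    rw [← hmap, ← RingHom.map_det, coe_evalRingHom]
  set q := (C ∘ ζ₁) ⬝ᵥ (A.adjugate *ᵥ (C ∘ (M *ᵥ ζ₂))) with hq
  have hq0 : q.coeff 0 = -(c * (M *ᵥ ζ₁ ⬝ᵥ ζ₂)) := by
    have h : q.coeff 0 = ζ₁ ⬝ᵥ (L.adjugate *ᵥ (M *ᵥ ζ₂)) := by
      rw [hq, coeff_zero_eq_eval_zero, ← coe_evalRingHom, RingHom.map_dotProduct]
      have hC (u : Fin (2 * n) → ℝ) : evalRingHom (0 : ℝ) ∘ C ∘ u = u := by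
        ext i
        simp
      rw [hC]
      congr 1
      ext i
      rw [Function.comp_apply, RingHom.map_mulVec, ← RingHom.mapMatrix_apply,
        RingHom.map_adjugate, hmap, zero_smul, sub_zero, hC]
    rw [h, dotProduct_mulVec, ← mulVec_transpose, adjugate_transpose, hL, ← hc,
      smul_dotProduct, dotProduct_mulVec, ← mulVec_transpose, hM, neg_mulVec, neg_dotProduct]
    simp
  have hc0 : A.det.coeff 0 = 0 := by
    simpa [mul_add, ← mul_assoc, coeff_X_pow_mul'] using congrArg (coeff · 0) hpoly
  have hpoly' : A.det + A.det * C (ζ₁ ⬝ᵥ ζ₂) * X = -(q * X ^ 2) := by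
    linear_combination hpoly
  have hc1 : A.det.coeff 1 = 0 := by
    simpa [coeff_mul_X_pow', coeff_mul_X, hc0] using congrArg (coeff · 1) hpoly'
  have hc2 : A.det.coeff 2 = -q.coeff 0 := by
    simpa [coeff_mul_X_pow', coeff_mul_X, hc1] using congrArg (coeff · 2) hpoly'
  have hderiv (p : ℝ[X]) : deriv (fun t => p.eval t) = fun t => p.derivative.eval t :=
    funext fun t => p.deriv
  refine ⟨by simpa using hdet, ?_, ?_⟩
  · rw [hD, hderiv]
    simp [← coeff_zero_eq_eval_zero, coeff_derivative, hc1]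
  · rw [hD, hderiv, hderiv]
    simp only [← coeff_zero_eq_eval_zero, coeff_derivative, hc2, hq0, hcoeff, zero_add,
      Nat.reduceAdd]
    push_cast
    ring
end

section
/- Let L be a real symmetric (2n)×(2n) matrix whose kernel is one-dimensional and spanned by a unit vector ζ₁, let M be an invertible real skew-symmetric (2n)×(2n) matrix, and let ζ₂ ∈ ℝ^{2n} satisfy L·ζ₂ = M·ζ₁. Let μ(L) denote the product of the nonzero eigenvalues of L (equivalently minus the coefficient of X in the characteristic polynomial det(X·I − L)). If μ(L)·⟨M·ζ₁, ζ₂⟩ < 0, then there exists a real number λ > 0 with det(L − λM) = 0. -/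
open Matrix

namespace Matrix

variable {ι : Type*} [Fintype ι] [DecidableEq ι]

/-- A real skew-symmetric matrix has nonnegative determinant. -/
theorem det_nonneg_of_transpose_eq_neg {M : Matrix ι ι ℝ} (hM : Mᵀ = -M) : 0 ≤ M.det := by
  by_contra! h
  let f : ℝ → ℝ := fun s => ((1 - s) • M + s • (1 : Matrix ι ι ℝ)).det
  have hf : Continuous f := by fun_prop
  obtain ⟨s, hs, hs0⟩ : (0 : ℝ) ∈ f '' Set.Ioo 0 1 :=
    intermediate_value_Ioo zero_le_one hf.continuousOn (by simpa [f] using h)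
  obtain ⟨v, hv, hv0⟩ := exists_mulVec_eq_zero_iff.mpr hs0
  have hskew : v ⬝ᵥ M *ᵥ v = 0 := by
    have h1 : v ⬝ᵥ M *ᵥ v = -(v ⬝ᵥ M *ᵥ v) := by
      conv_lhs => rw [dotProduct_mulVec, ← mulVec_transpose, hM, neg_mulVec, neg_dotProduct,
        dotProduct_comm]
    linarith
  have h2 : s * (v ⬝ᵥ v) = 0 := by
    have := congrArg (v ⬝ᵥ ·) hv0
    simpa [add_mulVec, smul_mulVec, dotProduct_add, dotProduct_smul, hskew] using this
  exact hv (dotProduct_self_eq_zero.mp ((mul_eq_zero.mp h2).resolve_left hs.1.ne'))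

/-- If a unit vector `v` lies in the kernel of `A`, the linear coefficient of the characteristic
polynomial of `A` is the value at `v` of the quadratic form of the adjugate of `-A`. -/
theorem charpoly_coeff_one_of_mulVec_eq_zero {R : Type*} [CommRing R] {A : Matrix ι ι R}
    {v : ι → R} (hA : A *ᵥ v = 0) (hv : v ⬝ᵥ v = 1) :
    A.charpoly.coeff 1 = v ⬝ᵥ (-A).adjugate *ᵥ v := by
  let w : ι → Polynomial R := Polynomial.C ∘ v
  have hw : w ⬝ᵥ w = 1 := by
    rw [← RingHom.map_dotProduct, hv, map_one]
  have hchar : A.charmatrix *ᵥ w = (Polynomial.X : Polynomial R) • w := by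
    have h0 : A.map Polynomial.C *ᵥ w = 0 := by
      funext i
      have := RingHom.map_mulVec Polynomial.C A v i
      rw [hA] at this
      simpa using this.symm
    rw [charmatrix, sub_mulVec]
    have : (Polynomial.C.mapMatrix A : Matrix ι ι (Polynomial R)) *ᵥ w = 0 := h0
    rw [this, sub_zero, scalar_apply, ← smul_one_eq_diagonal, smul_mulVec, one_mulVec]
  have hX : A.charpoly = Polynomial.X * (w ⬝ᵥ A.charmatrix.adjugate *ᵥ w) := by
    have h1 : A.charmatrix.adjugate *ᵥ (A.charmatrix *ᵥ w) = A.charpoly • w := by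
      rw [mulVec_mulVec, adjugate_mul, smul_mulVec, one_mulVec, charpoly]
    have h2 := congrArg (w ⬝ᵥ ·) h1
    simp only [hchar, mulVec_smul, dotProduct_smul, hw, smul_eq_mul, mul_one] at h2
    exact h2.symm
  have heval : (Polynomial.evalRingHom (0 : R)).mapMatrix A.charmatrix = -A := by
    ext i j
    simp [charmatrix_apply, diagonal_apply, apply_ite]
  have hwv : (Polynomial.evalRingHom (0 : R)) ∘ w = v := by
    funext i
    simp [w]
  rw [hX, Polynomial.coeff_X_mul, Polynomial.coeff_zero_eq_eval_zero,
    ← Polynomial.coe_evalRingHom, RingHom.map_dotProduct, hwv, ← heval,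
    ← RingHom.map_adjugate]
  congr 1
  funext i
  rw [Function.comp_apply, RingHom.map_mulVec, hwv]
  rfl

/-- The identity behind the expansion of `det (L - t M)` at `t = 0`, when `L` has kernel vector
`u` and generalized kernel vector `v`. -/
theorem det_sub_smul_mul_eq {R : Type*} [CommRing R] {L M : Matrix ι ι R} {u v : ι → R}
    (hu : L *ᵥ u = 0) (huu : u ⬝ᵥ u = 1) (hv : L *ᵥ v = M *ᵥ u) (t : R) :
    (L - t • M).det * (1 + t * (u ⬝ᵥ v)) =
      t ^ 2 * -(u ⬝ᵥ (L - t • M).adjugate *ᵥ (M *ᵥ v)) := by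
  have h1 : (L - t • M) *ᵥ (u + t • v) = -(t ^ 2) • (M *ᵥ v) := by
    rw [sub_mulVec, mulVec_add, mulVec_add, mulVec_smul, hu, hv, smul_mulVec, smul_mulVec,
      mulVec_smul, smul_smul, ← pow_two, neg_smul]
    abel
  have h2 : (L - t • M).adjugate *ᵥ ((L - t • M) *ᵥ (u + t • v)) =
      (L - t • M).det • (u + t • v) := by
    rw [mulVec_mulVec, adjugate_mul, smul_mulVec, one_mulVec]
  have h3 := congrArg (u ⬝ᵥ ·) h2
  simp only [h1, mulVec_smul, dotProduct_smul, dotProduct_add, huu, smul_eq_mul] at h3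
  rw [← h3]
  ring

end Matrix

/-- **Corollary 2.3 (instability criterion).** Let `L` be a real symmetric
`2n × 2n` matrix with one-dimensional kernel spanned by a unit vector `ζ₁`,
let `M` be an invertible skew-symmetric matrix, and let `ζ₂` satisfy
`L ζ₂ = M ζ₁`. If `μ(L) ⟨M ζ₁, ζ₂⟩ < 0`, where `μ(L)` is the product of the
nonzero eigenvalues of `L` (minus the coefficient of `X` in the characteristic
polynomial), then `det (L - λ M) = 0` for some real `λ > 0`. -/
theorem unstable_eigenvalue_exists {n : ℕ}
    (L M : Matrix (Fin (2 * n)) (Fin (2 * n)) ℝ)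
    (hL : Lᵀ = L) (hM : Mᵀ = -M) (hMinv : IsUnit M.det)
    (ζ₁ ζ₂ : Fin (2 * n) → ℝ)
    (hker : LinearMap.ker L.mulVecLin = Submodule.span ℝ {ζ₁})
    (hunit : ζ₁ ⬝ᵥ ζ₁ = 1)
    (h2 : L.mulVec ζ₂ = M.mulVec ζ₁)
    (hneg : (-(L.charpoly.coeff 1)) * (M.mulVec ζ₁ ⬝ᵥ ζ₂) < 0) :
    ∃ lam : ℝ, 0 < lam ∧ (L - lam • M).det = 0 := by
  have hn : n ≠ 0 := by
    rintro rfl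
    simp [dotProduct] at hunit
  have hL1 : L *ᵥ ζ₁ = 0 := by
    have : ζ₁ ∈ LinearMap.ker L.mulVecLin := hker ▸ Submodule.mem_span_singleton_self ζ₁
    simpa using this
  have hdet : L.det = 0 := by
    refine exists_mulVec_eq_zero_iff.mp ⟨ζ₁, ?_, hL1⟩
    rintro rfl
    simp at hunit
  have hadj : L.adjugate *ᵥ ζ₁ = (-(L.charpoly.coeff 1)) • ζ₁ := by
    have hmem : L.adjugate *ᵥ ζ₁ ∈ LinearMap.ker L.mulVecLin := by
      simp [mulVec_mulVec, mul_adjugate, hdet]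
    rw [hker, Submodule.mem_span_singleton] at hmem
    obtain ⟨c, hc⟩ := hmem
    have hodd : Odd (2 * n - 1) := ⟨n - 1, by omega⟩
    rw [charpoly_coeff_one_of_mulVec_eq_zero hL1 hunit, ← neg_one_smul ℝ L, adjugate_smul,
      Fintype.card_fin, hodd.neg_one_pow, smul_mulVec, ← hc]
    simp [hunit]
  have hlim : -(ζ₁ ⬝ᵥ L.adjugate *ᵥ (M *ᵥ ζ₂)) < 0 := by
    have hsymm : L.adjugateᵀ = L.adjugate := by rw [adjugate_transpose, hL]
    rw [dotProduct_mulVec, ← mulVec_transpose, hsymm, hadj, smul_dotProduct, dotProduct_mulVec,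
      ← mulVec_transpose, hM, neg_mulVec, neg_dotProduct, smul_eq_mul]
    linarith
  have hcont : Continuous fun t : ℝ => (L - t • M).det := by fun_prop
  obtain ⟨a, ha, hDa⟩ : ∃ a : ℝ, 0 < a ∧ (L - a • M).det < 0 := by
    have hg : Continuous fun t : ℝ => -(ζ₁ ⬝ᵥ (L - t • M).adjugate *ᵥ (M *ᵥ ζ₂)) := by fun_prop
    have hk : Continuous fun t : ℝ => 1 + t * (ζ₁ ⬝ᵥ ζ₂) := by fun_prop
    have hg0 := hg.tendsto 0 |>.eventually_lt_const (u := 0) (by simpa using hlim)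
    have hk0 := hk.tendsto 0 |>.eventually_const_lt (u := 0) (by simp)
    obtain ⟨a, ⟨hga, hka⟩, ha⟩ :=
      (((hg0.and hk0).filter_mono nhdsWithin_le_nhds).and
        (self_mem_nhdsWithin (s := Set.Ioi (0 : ℝ)))).exists
    refine ⟨a, ha, ?_⟩
    have := det_sub_smul_mul_eq hL1 hunit h2 a
    have h3 : (L - a • M).det * (1 + a * (ζ₁ ⬝ᵥ ζ₂)) < 0 :=
      this ▸ mul_neg_of_pos_of_neg (pow_pos ha 2) hga
    exact neg_of_mul_neg_left h3 hka.le
  obtain ⟨b, hb, hDb⟩ : ∃ b : ℝ, 0 < b ∧ 0 < (L - b • M).det := by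
    have hMpos : 0 < (-M).det := by
      rw [← hM, det_transpose]
      exact (det_nonneg_of_transpose_eq_neg hM).lt_of_ne' hMinv.ne_zero
    have hg : Continuous fun s : ℝ => (s • L - M).det := by fun_prop
    have hg0 := hg.tendsto 0 |>.eventually_const_lt (u := 0) (by simpa using hMpos)
    obtain ⟨s, hgs, hs⟩ :=
      ((hg0.filter_mono nhdsWithin_le_nhds).and
        (self_mem_nhdsWithin (s := Set.Ioi (0 : ℝ)))).exists
    have hs : 0 < s := hs
    refine ⟨s⁻¹, inv_pos.mpr hs, ?_⟩
    have : L - s⁻¹ • M = s⁻¹ • (s • L - M) := by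
      rw [smul_sub, smul_smul, inv_mul_cancel₀ hs.ne', one_smul]
    rw [this, det_smul]
    positivity
  obtain ⟨t, ht, ht0⟩ := isPreconnected_Ioi.intermediate_value (Set.mem_Ioi.mpr ha)
    (Set.mem_Ioi.mpr hb) hcont.continuousOn ⟨hDa.le, hDb.le⟩
  exact ⟨t, ht, ht0⟩
end

section
/- Let J be a skew-symmetric real n×n matrix, let B : ℝ → (real n×n matrices) be such that B(ξ) is symmetric for every ξ, and let u, v : ℝ → ℝⁿ be differentiable functions satisfying J·u′(ξ) = B(ξ)·u(ξ) and J·v′(ξ) = B(ξ)·v(ξ) for all ξ. If u(ξ) → 0 and v(ξ) → 0 as ξ → +∞, then ⟨J·u(ξ), v(ξ)⟩ = 0 for every ξ ∈ ℝ. In particular, the span of two such solutions is a Lagrangian subspace for the symplectic form Ω(a,b) = ⟨J·a, b⟩. -/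
open Matrix Filter

theorem Matrix.mulVec_dotProduct_eq {m n R : Type*} [Fintype m] [Fintype n] [CommSemiring R]
    (A : Matrix m n R) (x : n → R) (y : m → R) : A *ᵥ x ⬝ᵥ y = x ⬝ᵥ Aᵀ *ᵥ y := by
  rw [Matrix.mulVec_transpose, dotProduct_comm, Matrix.dotProduct_mulVec, dotProduct_comm]

theorem HasDerivAt.mulVec_dotProduct {m n : Type*} [Fintype m] [Fintype n]
    (A : Matrix m n ℝ) {u : ℝ → n → ℝ} {v : ℝ → m → ℝ} {u' : n → ℝ} {v' : m → ℝ} {x : ℝ}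
    (hu : HasDerivAt u u' x) (hv : HasDerivAt v v' x) :
    HasDerivAt (fun t => A *ᵥ u t ⬝ᵥ v t) (A *ᵥ u' ⬝ᵥ v x + A *ᵥ u x ⬝ᵥ v') x := by
  rw [hasDerivAt_pi] at hu hv
  simp only [Matrix.mulVec, dotProduct, ← Finset.sum_add_distrib]
  exact HasDerivAt.fun_sum fun i _ =>
    (HasDerivAt.fun_sum fun j _ => (hu j).const_mul (A i j)).mul (hv i)

/-- **Proposition 4.1 (Lagrangian property of the stable subspace).**
If `J` is skew-symmetric, `B(ξ)` is symmetric for every `ξ`, and `u, v` are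
differentiable solutions of `J u′ = B(ξ) u`, `J v′ = B(ξ) v` that tend to `0`
as `ξ → +∞`, then the symplectic pairing `⟨J u(ξ), v(ξ)⟩` vanishes for all
`ξ`. -/
theorem stable_subspace_lagrangian {n : ℕ}
    (J : Matrix (Fin n) (Fin n) ℝ) (hJ : Jᵀ = -J)
    (B : ℝ → Matrix (Fin n) (Fin n) ℝ) (hB : ∀ ξ, (B ξ)ᵀ = B ξ)
    (u v : ℝ → Fin n → ℝ)
    (hu : Differentiable ℝ u) (hv : Differentiable ℝ v)
    (hueq : ∀ ξ, J.mulVec (deriv u ξ) = (B ξ).mulVec (u ξ))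
    (hveq : ∀ ξ, J.mulVec (deriv v ξ) = (B ξ).mulVec (v ξ))
    (hulim : Tendsto u atTop (nhds 0))
    (hvlim : Tendsto v atTop (nhds 0)) :
    ∀ ξ : ℝ, J.mulVec (u ξ) ⬝ᵥ v ξ = 0 := by
  have hderiv : ∀ t, HasDerivAt (fun t => J *ᵥ u t ⬝ᵥ v t) 0 t := fun t => by
    convert (hu t).hasDerivAt.mulVec_dotProduct J (hv t).hasDerivAt using 1
    rw [hueq, mulVec_dotProduct_eq J, hJ, neg_mulVec, hveq, dotProduct_neg,
      mulVec_dotProduct_eq (B t), hB, add_neg_cancel]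
  have hlim : Tendsto (fun t => J *ᵥ u t ⬝ᵥ v t) atTop (nhds 0) := by
    have hcont : Continuous fun p : (Fin n → ℝ) × (Fin n → ℝ) => J *ᵥ p.1 ⬝ᵥ p.2 := by
      fun_prop
    simpa [Function.comp_def] using (hcont.tendsto (0, 0)).comp (hulim.prodMk_nhds hvlim)
  intro ξ
  refine tendsto_nhds_unique (tendsto_const_nhds.congr fun t => ?_) hlim
  exact is_const_of_deriv_eq_zero (fun t => (hderiv t).differentiableAt)
    (fun t => (hderiv t).deriv) ξ t
end

section
/- Let J, M be skew-symmetric complex n×n matrices (Jᵀ = −J, Mᵀ = −M), let B : ℝ → (complex n×n matrices) satisfy B(ξ)ᵀ = B(ξ) for every ξ, let λ ∈ ℂ, and let u, w : ℝ → ℂⁿ be differentiable functions satisfying J·u′(ξ) = (B(ξ) − λM)·u(ξ) and J·w′(ξ) = (B(ξ) + λM)·w(ξ) for all ξ. Then the bilinear pairing ξ ↦ (J·w(ξ))ᵀ·u(ξ) = Σᵢ (J·w(ξ))ᵢ · u(ξ)ᵢ is constant on ℝ. -/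
open Matrix

/-- Product rule for the bilinear dot product of two vector-valued functions. -/
theorem HasDerivAt.dotProduct_pi {ι 𝕜 A : Type*} [Fintype ι] [NontriviallyNormedField 𝕜]
    [NormedCommRing A] [NormedAlgebra 𝕜 A] {f g : 𝕜 → ι → A} {f' g' : ι → A} {x : 𝕜}
    (hf : HasDerivAt f f' x) (hg : HasDerivAt g g' x) :
    HasDerivAt (fun t => f t ⬝ᵥ g t) (f' ⬝ᵥ g x + f x ⬝ᵥ g') x := by
  simp only [dotProduct, ← Finset.sum_add_distrib]
  exact HasDerivAt.fun_sum fun i _ => (hasDerivAt_pi.1 hf i).mul (hasDerivAt_pi.1 hg i)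

/-- Multiplication by a constant matrix commutes with differentiation. -/
theorem HasDerivAt.const_mulVec {ι κ 𝕜 A : Type*} [Fintype ι] [Fintype κ]
    [NontriviallyNormedField 𝕜] [NormedCommRing A] [NormedAlgebra 𝕜 A] (C : Matrix κ ι A)
    {f : 𝕜 → ι → A} {f' : ι → A} {x : 𝕜} (hf : HasDerivAt f f' x) :
    HasDerivAt (fun t => C *ᵥ f t) (C *ᵥ f') x :=
  hasDerivAt_pi.2 fun k => by
    simpa [mulVec] using (hasDerivAt_const x (C k)).dotProduct_pi hf

/-- **Proposition 5.1 (symplectic adjoint pairing is constant).** Let `J, M`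
be skew-symmetric complex matrices, `B(ξ)` symmetric (`B(ξ)ᵀ = B(ξ)`) for each
`ξ`, and `λ ∈ ℂ`. If `u` solves `J u′ = (B(ξ) - λ M) u` and `w` solves the
symplectic adjoint system `J w′ = (B(ξ) + λ M) w`, then the bilinear pairing
`ξ ↦ (J w(ξ))ᵀ u(ξ)` (no complex conjugation) is constant on `ℝ`. -/
theorem symplectic_adjoint_pairing_constant {n : ℕ}
    (J M : Matrix (Fin n) (Fin n) ℂ)
    (hJ : Jᵀ = -J) (hM : Mᵀ = -M)
    (B : ℝ → Matrix (Fin n) (Fin n) ℂ) (hB : ∀ ξ, (B ξ)ᵀ = B ξ)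
    (lam : ℂ) (u w : ℝ → Fin n → ℂ)
    (hu : Differentiable ℝ u) (hw : Differentiable ℝ w)
    (hueq : ∀ ξ, J.mulVec (deriv u ξ) = (B ξ - lam • M).mulVec (u ξ))
    (hweq : ∀ ξ, J.mulVec (deriv w ξ) = (B ξ + lam • M).mulVec (w ξ)) :
    ∀ ξ₁ ξ₂ : ℝ,
      J.mulVec (w ξ₁) ⬝ᵥ u ξ₁ = J.mulVec (w ξ₂) ⬝ᵥ u ξ₂ := by
  have hd : ∀ ξ, HasDerivAt (fun ξ => J *ᵥ w ξ ⬝ᵥ u ξ) 0 ξ := by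
    intro ξ
    have h := ((hw ξ).hasDerivAt.const_mulVec J).dotProduct_pi (hu ξ).hasDerivAt
    have transpose_pairing (C : Matrix (Fin n) (Fin n) ℂ) (a b : Fin n → ℂ) :
        C *ᵥ a ⬝ᵥ b = a ⬝ᵥ Cᵀ *ᵥ b := by
      rw [dotProduct_mulVec, vecMul_transpose]
    have hT : (B ξ + lam • M)ᵀ = B ξ - lam • M := by
      rw [transpose_add, transpose_smul, hB, hM, smul_neg, sub_eq_add_neg]
    rwa [hweq, transpose_pairing, transpose_pairing J, hT, hJ, neg_mulVec, hueq,
      dotProduct_neg, add_neg_cancel] at h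
  exact is_const_of_deriv_eq_zero (fun ξ => (hd ξ).differentiableAt) fun ξ => (hd ξ).deriv
end

section
/- Let J, M be skew-symmetric real n×n matrices, let B : ℝ → (real n×n matrices) be such that B(ξ) is symmetric for every ξ, and let u, v : ℝ → ℝⁿ be differentiable functions satisfying J·u′(ξ) = B(ξ)·u(ξ) and J·v′(ξ) = B(ξ)·v(ξ) + M·u(ξ) for all ξ. If u(ξ) → 0 and v(ξ) → 0 as ξ → −∞, then ⟨J·v(ξ), u(ξ)⟩ = 0 for every ξ ∈ ℝ. -/
open Matrix Filter

namespace Matrix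

theorem mulVec_dotProduct_eq_dotProduct_transpose_mulVec {m n R : Type*} [Fintype m] [Fintype n]
    [CommSemiring R] (A : Matrix m n R) (x : n → R) (y : m → R) :
    A.mulVec x ⬝ᵥ y = x ⬝ᵥ Aᵀ.mulVec y := by
  rw [mulVec_transpose, dotProduct_comm, dotProduct_mulVec, dotProduct_comm]

theorem mulVec_dotProduct_self_of_transpose_eq_neg {n : Type*} [Fintype n]
    {A : Matrix n n ℝ} (hA : Aᵀ = -A) (x : n → ℝ) : A.mulVec x ⬝ᵥ x = 0 := by
  have h := mulVec_dotProduct_eq_dotProduct_transpose_mulVec A x x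
  rw [hA, neg_mulVec, dotProduct_neg, dotProduct_comm x] at h
  linarith

end Matrix

theorem HasDerivAt.dotProduct {n : Type*} [Fintype n] {f g : ℝ → n → ℝ} {f' g' : n → ℝ} {x : ℝ}
    (hf : HasDerivAt f f' x) (hg : HasDerivAt g g' x) :
    HasDerivAt (fun t ↦ f t ⬝ᵥ g t) (f' ⬝ᵥ g x + f x ⬝ᵥ g') x := by
  simp only [_root_.dotProduct, ← Finset.sum_add_distrib]
  exact HasDerivAt.fun_sum fun i _ ↦ (hasDerivAt_pi.1 hf i).mul (hasDerivAt_pi.1 hg i)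

theorem HasDerivAt.matrix_mulVec {m n : Type*} [Fintype m] [Fintype n] (A : Matrix m n ℝ)
    {f : ℝ → n → ℝ} {f' : n → ℝ} {x : ℝ} (hf : HasDerivAt f f' x) :
    HasDerivAt (fun t ↦ A.mulVec (f t)) (A.mulVec f') x :=
  A.mulVecLin.toContinuousLinearMap.hasFDerivAt.comp_hasDerivAt x hf

/-- **Vanishing of the pairing `Ω(Ẑ_c, Ẑ_ξ)`.** Let `J, M` be skew-symmetric
real matrices and `B(ξ)` symmetric for each `ξ`. If `u` solves `J u′ = B(ξ) u`
and `v` solves the inhomogeneous equation `J v′ = B(ξ) v + M u`, and both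
`u(ξ) → 0` and `v(ξ) → 0` as `ξ → -∞`, then `⟨J v(ξ), u(ξ)⟩ = 0` for every
`ξ`. -/
theorem pairing_Zc_Zxi_vanishes {n : ℕ}
    (J M : Matrix (Fin n) (Fin n) ℝ)
    (hJ : Jᵀ = -J) (hM : Mᵀ = -M)
    (B : ℝ → Matrix (Fin n) (Fin n) ℝ) (hB : ∀ ξ, (B ξ)ᵀ = B ξ)
    (u v : ℝ → Fin n → ℝ)
    (hu : Differentiable ℝ u) (hv : Differentiable ℝ v)
    (hueq : ∀ ξ, J.mulVec (deriv u ξ) = (B ξ).mulVec (u ξ))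
    (hveq : ∀ ξ, J.mulVec (deriv v ξ) = (B ξ).mulVec (v ξ) + M.mulVec (u ξ))
    (hulim : Tendsto u atBot (nhds 0))
    (hvlim : Tendsto v atBot (nhds 0)) :
    ∀ ξ : ℝ, J.mulVec (v ξ) ⬝ᵥ u ξ = 0 := by
  have hderiv (ξ : ℝ) : HasDerivAt (fun t ↦ J.mulVec (v t) ⬝ᵥ u t) 0 ξ := by
    have h := ((hv ξ).hasDerivAt.matrix_mulVec J).dotProduct (hu ξ).hasDerivAt
    convert h using 1
    rw [hveq, add_dotProduct, mulVec_dotProduct_self_of_transpose_eq_neg hM,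
      mulVec_dotProduct_eq_dotProduct_transpose_mulVec J,
      mulVec_dotProduct_eq_dotProduct_transpose_mulVec (B ξ), hB, hJ, neg_mulVec, hueq,
      dotProduct_neg]
    ring
  have hlim : Tendsto (fun t ↦ J.mulVec (v t) ⬝ᵥ u t) atBot (nhds 0) := by
    have hcont : Continuous fun p : (Fin n → ℝ) × (Fin n → ℝ) ↦ J.mulVec p.1 ⬝ᵥ p.2 := by
      fun_prop
    simpa [Function.comp_def] using (hcont.tendsto (0, 0)).comp (hvlim.prodMk_nhds hulim)
  intro ξ
  have hconst (t : ℝ) : J.mulVec (v t) ⬝ᵥ u t = J.mulVec (v ξ) ⬝ᵥ u ξ :=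
    is_const_of_deriv_eq_zero (fun s ↦ (hderiv s).differentiableAt) (fun s ↦ (hderiv s).deriv) t ξ
  simp only [hconst] at hlim
  exact tendsto_nhds_unique tendsto_const_nhds hlim
end

section
/- Let c be a real number with −1 < c < 1 and set α = 1/√(1 − c²). Then the function φ : ℝ → ℝ defined by φ(ξ) = (cosh(αξ))⁻² is twice differentiable and satisfies (1 − c²)·φ″(ξ) = 4·φ(ξ) − 6·φ(ξ)² for all ξ ∈ ℝ. -/
theorem hasDerivAt_inv_cosh_mul_sq (a x : ℝ) :
    HasDerivAt (fun y ↦ (Real.cosh (a * y) ^ 2)⁻¹)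
      (-2 * a * Real.sinh (a * x) / Real.cosh (a * x) ^ 3) x := by
  have hpos := Real.cosh_pos (a * x)
  have hlin : HasDerivAt (fun y ↦ a * y) a x := by
    simpa using (hasDerivAt_id x).const_mul a
  refine ((hlin.cosh.fun_pow 2).fun_inv (by positivity)).congr_deriv ?_
  field_simp
  push_cast
  ring

theorem hasDerivAt_sinh_mul_div_cosh_mul_cube (a x : ℝ) :
    HasDerivAt (fun y ↦ -2 * a * Real.sinh (a * y) / Real.cosh (a * y) ^ 3)
      (a ^ 2 * (4 * (Real.cosh (a * x) ^ 2)⁻¹ - 6 * (Real.cosh (a * x) ^ 2)⁻¹ ^ 2)) x := by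
  have hpos := Real.cosh_pos (a * x)
  have hlin : HasDerivAt (fun y ↦ a * y) a x := by
    simpa using (hasDerivAt_id x).const_mul a
  refine ((hlin.sinh.const_mul (-2 * a)).fun_div (hlin.cosh.fun_pow 3) (by positivity)).congr_deriv ?_
  field_simp
  push_cast
  ring_nf
  rw [Real.sinh_sq]
  ring

/-- **Exact solitary-wave profile.** For `-1 < c < 1`, `α = 1/√(1 - c²)`, the
function `φ(ξ) = sech²(α ξ)` is twice differentiable and satisfies
`(1 - c²) φ″ = 4 φ - 6 φ²`. -/
theorem solitary_wave_profile (c : ℝ) (hc1 : -1 < c) (hc2 : c < 1)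
    (α : ℝ) (hα : α = 1 / Real.sqrt (1 - c ^ 2))
    (φ : ℝ → ℝ) (hφ : ∀ ξ, φ ξ = (Real.cosh (α * ξ) ^ 2)⁻¹) :
    Differentiable ℝ φ ∧ Differentiable ℝ (deriv φ) ∧
      ∀ ξ : ℝ, (1 - c ^ 2) * deriv (deriv φ) ξ = 4 * φ ξ - 6 * φ ξ ^ 2 := by
  have hc : 0 < 1 - c ^ 2 := by nlinarith
  have hα2 : (1 - c ^ 2) * α ^ 2 = 1 := by
    rw [hα, div_pow, Real.sq_sqrt hc.le]
    field_simp
  obtain rfl : φ = fun ξ ↦ (Real.cosh (α * ξ) ^ 2)⁻¹ := funext hφ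
  have hderiv := funext fun ξ ↦ (hasDerivAt_inv_cosh_mul_sq α ξ).deriv
  rw [hderiv]
  refine ⟨fun ξ ↦ (hasDerivAt_inv_cosh_mul_sq α ξ).differentiableAt,
    fun ξ ↦ (hasDerivAt_sinh_mul_div_cosh_mul_cube α ξ).differentiableAt, fun ξ ↦ ?_⟩
  rw [(hasDerivAt_sinh_mul_div_cosh_mul_cube α ξ).deriv, ← mul_assoc, hα2, one_mul]
end

section
/- Let p > 0 and α > 0 be real numbers and set γ = √(4 + 3p). Define ψ⁺(ξ) = e^{−αγξ}·( pγ/5 + ((5 + 6p)/5)·tanh(αξ) + γ·tanh(αξ)² + tanh(αξ)³ ) and ψ⁻(ξ) = e^{+αγξ}·( −pγ/5 + ((5 + 6p)/5)·tanh(αξ) − γ·tanh(αξ)² + tanh(αξ)³ ). Then for every ξ ∈ ℝ, the Wronskian-type expression ψ⁺(ξ)·(ψ⁻)′(ξ) − (ψ⁺)′(ξ)·ψ⁻(ξ) is equal to the constant (2pαγ/25)·(5 − 3p)·(1 + p). -/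
/-- The derivative of `tanh`, written as a polynomial in `tanh`. -/
theorem Real.hasDerivAt_tanh_one_sub_sq (x : ℝ) :
    HasDerivAt Real.tanh (1 - Real.tanh x ^ 2) x := by
  have hc : Real.cosh x ≠ 0 := (Real.cosh_pos x).ne'
  have h := (Real.hasDerivAt_sinh x).div (Real.hasDerivAt_cosh x) hc
  have hfun : Real.tanh = Real.sinh / Real.cosh := funext Real.tanh_eq_sinh_div_cosh
  rw [← hfun] at h
  refine h.congr_deriv ?_
  rw [Real.tanh_eq_sinh_div_cosh]
  field_simp

/-- The derivative of an exponential times a cubic polynomial in `tanh`. -/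
theorem hasDerivAt_exp_mul_cubic_tanh (k α a b c d ξ : ℝ) :
    HasDerivAt
      (fun x => Real.exp (k * x) * (a + b * Real.tanh (α * x)
        + c * Real.tanh (α * x) ^ 2 + d * Real.tanh (α * x) ^ 3))
      (Real.exp (k * ξ) *
        (k * (a + b * Real.tanh (α * ξ) + c * Real.tanh (α * ξ) ^ 2 + d * Real.tanh (α * ξ) ^ 3)
          + α * (1 - Real.tanh (α * ξ) ^ 2)
            * (b + 2 * c * Real.tanh (α * ξ) + 3 * d * Real.tanh (α * ξ) ^ 2))) ξ := by
  have ht : HasDerivAt (fun x => Real.tanh (α * x)) ((1 - Real.tanh (α * ξ) ^ 2) * α) ξ :=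
    (Real.hasDerivAt_tanh_one_sub_sq (α * ξ)).comp ξ (hasDerivAt_const_mul α)
  have he : HasDerivAt (fun x => Real.exp (k * x)) (Real.exp (k * ξ) * k) ξ :=
    (hasDerivAt_const_mul k).exp
  refine (he.mul ((((ht.const_mul b).const_add a).add ((ht.pow 2).const_mul c)).add
    ((ht.pow 3).const_mul d))).congr_deriv ?_
  simp
  ring

/-- **Constancy and value of the Wronskian of `ψ⁺` and `ψ⁻`.** For `p > 0`,
`α > 0`, `γ = √(4 + 3p)`, the exact solutions
`ψ⁺(ξ) = e^{-αγξ}(pγ/5 + ((5+6p)/5) tanh(αξ) + γ tanh²(αξ) + tanh³(αξ))` and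
`ψ⁻(ξ) = e^{+αγξ}(-pγ/5 + ((5+6p)/5) tanh(αξ) - γ tanh²(αξ) + tanh³(αξ))`
satisfy `ψ⁺ (ψ⁻)′ - (ψ⁺)′ ψ⁻ = (2pαγ/25)(5 - 3p)(1 + p)` for every `ξ`. -/
theorem wronskian_transversality (p α : ℝ) (hp : 0 < p) (hα : 0 < α)
    (γ : ℝ) (hγ : γ = Real.sqrt (4 + 3 * p))
    (ψp ψm : ℝ → ℝ)
    (hψp : ∀ ξ : ℝ, ψp ξ = Real.exp (-(α * γ * ξ)) *
      (p * γ / 5 + (5 + 6 * p) / 5 * Real.tanh (α * ξ)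
        + γ * Real.tanh (α * ξ) ^ 2 + Real.tanh (α * ξ) ^ 3))
    (hψm : ∀ ξ : ℝ, ψm ξ = Real.exp (α * γ * ξ) *
      (-(p * γ) / 5 + (5 + 6 * p) / 5 * Real.tanh (α * ξ)
        - γ * Real.tanh (α * ξ) ^ 2 + Real.tanh (α * ξ) ^ 3)) :
    ∀ ξ : ℝ, ψp ξ * deriv ψm ξ - deriv ψp ξ * ψm ξ =
      2 * p * α * γ / 25 * (5 - 3 * p) * (1 + p) := by
  intro ξ
  have hγ2 : γ ^ 2 = 4 + 3 * p := by
    rw [hγ, Real.sq_sqrt (by positivity)]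
  have hpγ : p = (γ ^ 2 - 4) / 3 := by linarith
  have hp' := (hasDerivAt_exp_mul_cubic_tanh (-(α * γ)) α
    (p * γ / 5) ((5 + 6 * p) / 5) γ 1 ξ).congr_of_eventuallyEq
      (f₁ := ψp) (.of_forall fun x => by rw [hψp]; ring_nf)
  have hm' := (hasDerivAt_exp_mul_cubic_tanh (α * γ) α
    (-(p * γ) / 5) ((5 + 6 * p) / 5) (-γ) 1 ξ).congr_of_eventuallyEq
      (f₁ := ψm) (.of_forall fun x => by rw [hψm]; ring_nf)
  rw [hp'.deriv, hm'.deriv, hψp, hψm, neg_mul (α * γ) ξ, Real.exp_neg]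
  have hE : Real.exp (α * γ * ξ) ≠ 0 := Real.exp_ne_zero _
  generalize Real.exp (α * γ * ξ) = E at hE ⊢
  generalize Real.tanh (α * ξ) = T
  rw [hpγ]
  field_simp
  ring
end
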